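/- arXiv:1002.4439 — 7 statements merged into one kernel-verified Lean document; each statement's English description precedes it below -/
import Mathlib

section
/- Let c₁, b₁ be real numbers and define f, g : U → ℝ on the open set U = {(x,y) ∈ ℝ² : e^{c₁·x} ≠ 1 and e^{b₁·y} ≠ 1} by f(x,y) = φ_{c₁}(x) and g(x,y) = φ_{b₁}(y), where φ_c(t) = c·(1 + e^{c·t})/(1 − e^{c·t}). Then on U the pair (f,g) satisfies the system of partial differential equations f_{xx} + f_{yy} − f·f_x − g·f_y = 0 and g_{xx} + g_{yy} − f·g_x − g·g_y = 0 (subscripts denoting partial derivatives). -/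
/-- `φ_c(t) = c·(1 + e^{c·t})/(1 − e^{c·t})`. -/
noncomputable def phiFun (c : ℝ) : ℝ → ℝ :=
  fun t => c * (1 + Real.exp (c * t)) / (1 - Real.exp (c * t))

/-- Partial derivative in the first variable of a function on `ℝ × ℝ`. -/
noncomputable def pdx (h : ℝ × ℝ → ℝ) : ℝ × ℝ → ℝ :=
  fun p => fderiv ℝ h p (1, 0)

/-- Partial derivative in the second variable of a function on `ℝ × ℝ`. -/
noncomputable def pdy (h : ℝ × ℝ → ℝ) : ℝ × ℝ → ℝ :=
  fun p => fderiv ℝ h p (0, 1)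

open Filter Topology

/-- The derivative `2c²e^{ct}/(1 − e^{ct})²` of `phiFun c`. -/
noncomputable def phiDeriv (c : ℝ) : ℝ → ℝ :=
  fun t => 2 * c ^ 2 * Real.exp (c * t) / (1 - Real.exp (c * t)) ^ 2

lemma hasDerivAt_exp_const_mul (c t : ℝ) :
    HasDerivAt (fun t => Real.exp (c * t)) (c * Real.exp (c * t)) t := by
  simpa [mul_comm] using ((hasDerivAt_id t).const_mul c).exp

lemma hasDerivAt_phiFun {c t : ℝ} (h : Real.exp (c * t) ≠ 1) :
    HasDerivAt (phiFun c) (phiDeriv c t) t := by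
  have h' : 1 - Real.exp (c * t) ≠ 0 := sub_ne_zero.mpr h.symm
  have hE := hasDerivAt_exp_const_mul c t
  refine (((hE.const_add 1).const_mul c).div (hE.const_sub 1) h').congr_deriv ?_
  unfold phiDeriv
  field_simp
  ring

lemma hasDerivAt_phiDeriv {c t : ℝ} (h : Real.exp (c * t) ≠ 1) :
    HasDerivAt (phiDeriv c) (phiFun c t * phiDeriv c t) t := by
  have h' : 1 - Real.exp (c * t) ≠ 0 := sub_ne_zero.mpr h.symm
  have hE := hasDerivAt_exp_const_mul c t
  refine ((hE.const_mul (2 * c ^ 2)).div ((hE.const_sub 1).pow 2)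
    (pow_ne_zero 2 h')).congr_deriv ?_
  simp only [phiDeriv, phiFun, Pi.pow_apply]
  field_simp
  ring

lemma pdx_pdy_of_eventuallyEq_fst {h : ℝ × ℝ → ℝ} {u : ℝ → ℝ} {u' : ℝ} {p : ℝ × ℝ}
    (hu : HasDerivAt u u' p.1) (heq : h =ᶠ[𝓝 p] fun q => u q.1) :
    pdx h p = u' ∧ pdy h p = 0 := by
  have hd := (hu.comp_hasFDerivAt p (hasFDerivAt_fst (𝕜 := ℝ))).congr_of_eventuallyEq heq
  simp [pdx, pdy, hd.fderiv]

lemma pdx_pdy_of_eventuallyEq_snd {h : ℝ × ℝ → ℝ} {u : ℝ → ℝ} {u' : ℝ} {p : ℝ × ℝ}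
    (hu : HasDerivAt u u' p.2) (heq : h =ᶠ[𝓝 p] fun q => u q.2) :
    pdx h p = 0 ∧ pdy h p = u' := by
  have hd := (hu.comp_hasFDerivAt p (hasFDerivAt_snd (𝕜 := ℝ))).congr_of_eventuallyEq heq
  simp [pdx, pdy, hd.fderiv]

/-- On the open set `U = {(x,y) : e^{c₁x} ≠ 1, e^{b₁y} ≠ 1}`, the pair
`f(x,y) = φ_{c₁}(x)`, `g(x,y) = φ_{b₁}(y)` satisfies the system
`f_{xx} + f_{yy} − f·f_x − g·f_y = 0` and `g_{xx} + g_{yy} − f·g_x − g·g_y = 0`. -/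
theorem phi_pair_solves_biharmonic_system (c₁ b₁ : ℝ)
    (f g : ℝ × ℝ → ℝ)
    (hf : ∀ p : ℝ × ℝ, f p = phiFun c₁ p.1)
    (hg : ∀ p : ℝ × ℝ, g p = phiFun b₁ p.2) :
    ∀ p : ℝ × ℝ, Real.exp (c₁ * p.1) ≠ 1 → Real.exp (b₁ * p.2) ≠ 1 →
      (pdx (pdx f) p + pdy (pdy f) p - f p * pdx f p - g p * pdy f p = 0 ∧
       pdx (pdx g) p + pdy (pdy g) p - f p * pdx g p - g p * pdy g p = 0) := by
  obtain rfl : f = fun p => phiFun c₁ p.1 := funext hf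
  obtain rfl : g = fun p => phiFun b₁ p.2 := funext hg
  intro p hx hy
  have df (q : ℝ × ℝ) (hq : Real.exp (c₁ * q.1) ≠ 1) :=
    pdx_pdy_of_eventuallyEq_fst (hasDerivAt_phiFun hq) (EventuallyEq.refl (𝓝 q) _)
  have dg (q : ℝ × ℝ) (hq : Real.exp (b₁ * q.2) ≠ 1) :=
    pdx_pdy_of_eventuallyEq_snd (hasDerivAt_phiFun hq) (EventuallyEq.refl (𝓝 q) _)
  have hxU : ∀ᶠ q : ℝ × ℝ in 𝓝 p, Real.exp (c₁ * q.1) ≠ 1 :=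
    ContinuousAt.eventually_ne (by fun_prop) hx
  have hyU : ∀ᶠ q : ℝ × ℝ in 𝓝 p, Real.exp (b₁ * q.2) ≠ 1 :=
    ContinuousAt.eventually_ne (by fun_prop) hy
  have fxx := (pdx_pdy_of_eventuallyEq_fst (hasDerivAt_phiDeriv hx)
    (hxU.mono fun q hq => (df q hq).1)).1
  have fyy := (pdx_pdy_of_eventuallyEq_fst (hasDerivAt_const p.1 (0 : ℝ))
    (hxU.mono fun q hq => (df q hq).2)).2
  have gxx := (pdx_pdy_of_eventuallyEq_snd (hasDerivAt_const p.2 (0 : ℝ))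
    (hyU.mono fun q hq => (dg q hq).1)).1
  have gyy := (pdx_pdy_of_eventuallyEq_snd (hasDerivAt_phiDeriv hy)
    (hyU.mono fun q hq => (dg q hq).2)).2
  rw [fxx, fyy, gxx, gyy, (df p hx).1, (df p hx).2, (dg p hy).1, (dg p hy).2]
  constructor <;> ring
end

section
/- Define smooth vector fields on the open set U = ℝ³ by e₁(x,y,z) = (1,0,0), e₂(x,y,z) = (0, −x/√(1+x²), −√(1+x²)), and e₃(x,y,z) = (0, 1/√(1+x²), 0). Then their Lie brackets satisfy, at every point p = (x,y,z): [e₁,e₂](p) = (x/(1+x²))·e₂(p) − ((1−x²)/(1+x²))·e₃(p), [e₁,e₃](p) = −(x/(1+x²))·e₃(p), and [e₂,e₃](p) = 0. -/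
open VectorField

/-- The derivative of a map depending on the first coordinate only. -/
theorem fderiv_comp_fst_apply {E F : Type*} [NormedAddCommGroup E] [NormedSpace ℝ E]
    [NormedAddCommGroup F] [NormedSpace ℝ F] {f : ℝ → F} {f' : F} {p : ℝ × E}
    (hf : HasDerivAt f f' p.1) (v : ℝ × E) :
    fderiv ℝ (fun q : ℝ × E => f q.1) p v = v.1 • f' := by
  have h : HasFDerivAt (fun q : ℝ × E => f q.1) _ p :=
    hf.hasFDerivAt.comp p hasFDerivAt_fst
  rw [h.fderiv]
  simp

theorem hasDerivAt_sqrt_one_add_sq (x : ℝ) :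
    HasDerivAt (fun t : ℝ => Real.sqrt (1 + t ^ 2)) (x / Real.sqrt (1 + x ^ 2)) x := by
  have hpos : 1 + x ^ 2 ≠ 0 := by positivity
  convert ((hasDerivAt_pow 2 x).const_add 1).sqrt hpos using 1
  simp
  field_simp

/-- The bracket relations of the orthonormal frame on the Nil space
`(ℝ³, dx² + dy² + (dz − x dy)²)` adapted to the Riemannian submersion `(x,y,z) ↦ (x,z)`:
`[e₁,e₂] = (x/(1+x²))e₂ − ((1−x²)/(1+x²))e₃`, `[e₁,e₃] = −(x/(1+x²))e₃`, `[e₂,e₃] = 0`. -/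
theorem nil_adapted_frame_brackets
    (e₁ e₂ e₃ : ℝ × ℝ × ℝ → ℝ × ℝ × ℝ)
    (he₁ : ∀ p : ℝ × ℝ × ℝ, e₁ p = (1, 0, 0))
    (he₂ : ∀ p : ℝ × ℝ × ℝ, e₂ p =
      (0, -p.1 / Real.sqrt (1 + p.1 ^ 2), -Real.sqrt (1 + p.1 ^ 2)))
    (he₃ : ∀ p : ℝ × ℝ × ℝ, e₃ p = (0, 1 / Real.sqrt (1 + p.1 ^ 2), 0)) :
    ∀ p : ℝ × ℝ × ℝ,
      lieBracket ℝ e₁ e₂ p =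
        (p.1 / (1 + p.1 ^ 2)) • e₂ p - ((1 - p.1 ^ 2) / (1 + p.1 ^ 2)) • e₃ p ∧
      lieBracket ℝ e₁ e₃ p = -(p.1 / (1 + p.1 ^ 2)) • e₃ p ∧
      lieBracket ℝ e₂ e₃ p = 0 := by
  intro p
  obtain rfl : e₁ = _ := funext he₁
  obtain rfl : e₂ = _ := funext he₂
  obtain rfl : e₃ = _ := funext he₃
  have hsq : Real.sqrt (1 + p.1 ^ 2) ^ 2 = 1 + p.1 ^ 2 := Real.sq_sqrt (by positivity)
  have hr : Real.sqrt (1 + p.1 ^ 2) ≠ 0 := by positivity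
  have hs := hasDerivAt_sqrt_one_add_sq p.1
  have h₂ := fderiv_comp_fst_apply (p := p)
    ((hasDerivAt_const p.1 (0 : ℝ)).prodMk (((hasDerivAt_id' p.1).neg.div hs hr).prodMk hs.neg))
  have h₃ := fderiv_comp_fst_apply (p := p)
    ((hasDerivAt_const p.1 (0 : ℝ)).prodMk
      (((hasDerivAt_const p.1 (1 : ℝ)).div hs hr).prodMk (hasDerivAt_const p.1 (0 : ℝ))))
  simp only [Pi.neg_apply, Pi.div_apply] at h₂ h₃
  simp only [lieBracket, h₂, h₃, fderiv_fun_const, Pi.zero_apply,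
    _root_.zero_apply, sub_zero, zero_smul, one_smul, and_true]
  clear h₂ h₃ hs
  generalize Real.sqrt (1 + p.1 ^ 2) = r at hsq hr ⊢
  rw [← hsq]
  refine ⟨?_, ?_⟩
  · ext
    · simp
    · simp
      field_simp
      linear_combination -hsq
    · simp
      field_simp
  · ext
    · simp
    · simp
      field_simp
    · simp
end

section
/- Define κ(x) = −x/(1+x²) and f₂(x) = x/(1+x²) on ℝ, and let E(x) = −κ''(x) + f₂(x)·κ'(x) + κ(x)·κ'(x) + κ(x)·(2·f₂(x)² − f₂'(x)). Then E(1) = −3/4; in particular E does not vanish identically on ℝ. -/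
theorem hasDerivAt_div_one_add_sq (x : ℝ) :
    HasDerivAt (fun y : ℝ => y / (1 + y ^ 2)) ((1 - x ^ 2) / (1 + x ^ 2) ^ 2) x := by
  have h := (hasDerivAt_id' x).fun_div ((hasDerivAt_pow 2 x).const_add 1)
    (by positivity : (1 : ℝ) + x ^ 2 ≠ 0)
  refine h.congr_deriv ?_
  push_cast
  ring

theorem hasDerivAt_sq_sub_one_div_sq_at_one :
    HasDerivAt (fun y : ℝ => (y ^ 2 - 1) / (1 + y ^ 2) ^ 2) (1 / 2) 1 := by
  have h := ((hasDerivAt_pow 2 (1 : ℝ)).sub_const 1).fun_div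
    (((hasDerivAt_pow 2 (1 : ℝ)).const_add 1).fun_pow 2) (by norm_num)
  refine h.congr_deriv ?_
  norm_num

/-- For the Nil-space Riemannian submersion data `κ(x) = −x/(1+x²)`, `f₂(x) = x/(1+x²)`,
the left-hand side `E = −κ'' + f₂κ' + κκ' + κ(2f₂² − f₂')` of the biharmonicity equation
satisfies `E(1) = −3/4`; in particular `E` does not vanish identically. -/
theorem nil_submersion_not_biharmonic
    (κ f₂ E : ℝ → ℝ)
    (hκ : ∀ x, κ x = -x / (1 + x ^ 2))
    (hf₂ : ∀ x, f₂ x = x / (1 + x ^ 2))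
    (hE : ∀ x, E x = -(deriv (deriv κ) x) + f₂ x * deriv κ x + κ x * deriv κ x
      + κ x * (2 * f₂ x ^ 2 - deriv f₂ x)) :
    E 1 = -3 / 4 ∧ ¬ (∀ x : ℝ, E x = 0) := by
  have hf₂' : deriv f₂ 1 = 0 := by
    rw [funext hf₂, (hasDerivAt_div_one_add_sq 1).deriv]
    norm_num
  have hκ' : deriv κ = fun x => (x ^ 2 - 1) / (1 + x ^ 2) ^ 2 := by
    have hκ_neg : κ = fun x => -(x / (1 + x ^ 2)) := by
      funext x
      rw [hκ, neg_div]
    funext x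
    rw [hκ_neg, (hasDerivAt_div_one_add_sq x).fun_neg.deriv]
    ring
  have hE_one : E 1 = -3 / 4 := by
    rw [hE, hf₂', hκ', hasDerivAt_sq_sub_one_div_sq_at_one.deriv, hκ, hf₂]
    norm_num
  refine ⟨hE_one, fun h => ?_⟩
  have h_zero := h 1
  rw [hE_one] at h_zero
  norm_num at h_zero
end

section
/- Let U ⊆ ℝ³ be open and let e₁, e₂, e₃ : U → ℝ³ be C^∞ vector fields that are linearly independent at every point of U. Let f₁, f₂, κ₁, κ₂, σ : U → ℝ be C^∞ functions such that on U the Lie brackets satisfy [e₁,e₃] = κ₁·e₃, [e₂,e₃] = κ₂·e₃, and [e₁,e₂] = f₁·e₁ + f₂·e₂ − 2σ·e₃. Then at every p ∈ U: (Df₁)_p(e₃(p)) = 0, (Df₂)_p(e₃(p)) = 0, and 2·(Dσ)_p(e₃(p)) + κ₁(p)f₁(p) + κ₂(p)f₂(p) + (Dκ₁)_p(e₂(p)) − (Dκ₂)_p(e₁(p)) = 0. -/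
open VectorField

/-- For an adapted frame of a Riemannian submersion from a 3-manifold with integrability
data `f₁, f₂, κ₁, κ₂, σ`, i.e. `[e₁,e₃] = κ₁e₃`, `[e₂,e₃] = κ₂e₃`,
`[e₁,e₂] = f₁e₁ + f₂e₂ − 2σe₃`, the data `f₁, f₂` are constant along `e₃`, and the
Jacobi-identity relation `2e₃(σ) + κ₁f₁ + κ₂f₂ + e₂(κ₁) − e₁(κ₂) = 0` holds. -/
theorem adapted_frame_jacobi_identity
    (U : Set (ℝ × ℝ × ℝ)) (hU : IsOpen U)
    (e₁ e₂ e₃ : ℝ × ℝ × ℝ → ℝ × ℝ × ℝ)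
    (he₁ : ContDiffOn ℝ (⊤ : ℕ∞) e₁ U) (he₂ : ContDiffOn ℝ (⊤ : ℕ∞) e₂ U) (he₃ : ContDiffOn ℝ (⊤ : ℕ∞) e₃ U)
    (hind : ∀ p ∈ U, LinearIndependent ℝ ![e₁ p, e₂ p, e₃ p])
    (f₁ f₂ κ₁ κ₂ σ : ℝ × ℝ × ℝ → ℝ)
    (hf₁ : ContDiffOn ℝ (⊤ : ℕ∞) f₁ U) (hf₂ : ContDiffOn ℝ (⊤ : ℕ∞) f₂ U)
    (hκ₁ : ContDiffOn ℝ (⊤ : ℕ∞) κ₁ U) (hκ₂ : ContDiffOn ℝ (⊤ : ℕ∞) κ₂ U)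
    (hσ : ContDiffOn ℝ (⊤ : ℕ∞) σ U)
    (hb₁₃ : ∀ p ∈ U, lieBracket ℝ e₁ e₃ p = κ₁ p • e₃ p)
    (hb₂₃ : ∀ p ∈ U, lieBracket ℝ e₂ e₃ p = κ₂ p • e₃ p)
    (hb₁₂ : ∀ p ∈ U, lieBracket ℝ e₁ e₂ p = f₁ p • e₁ p + f₂ p • e₂ p - (2 * σ p) • e₃ p) :
    ∀ p ∈ U,
      fderiv ℝ f₁ p (e₃ p) = 0 ∧
      fderiv ℝ f₂ p (e₃ p) = 0 ∧
      2 * fderiv ℝ σ p (e₃ p) + κ₁ p * f₁ p + κ₂ p * f₂ p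
        + fderiv ℝ κ₁ p (e₂ p) - fderiv ℝ κ₂ p (e₁ p) = 0 := by
  intro p hp
  have hn : U ∈ nhds p := hU.mem_nhds hp
  have smooth_at {F : Type} [NormedAddCommGroup F] [NormedSpace ℝ F] {g : ℝ × ℝ × ℝ → F}
      (hg : ContDiffOn ℝ (⊤ : ℕ∞) g U) : DifferentiableAt ℝ g p :=
    (hg.contDiffAt hn).differentiableAt (by simp)
  have smooth_min {g : ℝ × ℝ × ℝ → ℝ × ℝ × ℝ} (hg : ContDiffOn ℝ (⊤ : ℕ∞) g U) :
      ContDiffAt ℝ (minSmoothness ℝ 2) g p :=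
    (hg.contDiffAt hn).of_le (by
      rw [minSmoothness_of_isRCLikeNormedField]
      exact WithTop.coe_le_coe.2 (le_top : (2 : ℕ∞) ≤ ⊤))
  have d₁ := smooth_at he₁
  have d₂ := smooth_at he₂
  have d₃ := smooth_at he₃
  have c₁ := smooth_at hf₁
  have c₂ := smooth_at hf₂
  have cσ : DifferentiableAt ℝ (fun q ↦ -(2 * σ q)) p := ((smooth_at hσ).const_mul 2).neg
  have jacobi := leibniz_identity_lieBracket le_rfl (smooth_min he₁) (smooth_min he₂)
    (smooth_min he₃)
  have E₁₃ : lieBracket ℝ e₁ e₃ =ᶠ[nhds p] fun q ↦ κ₁ q • e₃ q :=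
    Filter.eventually_of_mem hn hb₁₃
  have E₂₃ : lieBracket ℝ e₂ e₃ =ᶠ[nhds p] fun q ↦ κ₂ q • e₃ q :=
    Filter.eventually_of_mem hn hb₂₃
  have E₁₂ : lieBracket ℝ e₁ e₂ =ᶠ[nhds p] (fun q ↦ f₁ q • e₁ q) + (fun q ↦ f₂ q • e₂ q)
      + fun q ↦ (-(2 * σ q)) • e₃ q :=
    Filter.eventually_of_mem hn fun q hq ↦ by
      simp [hb₁₂ q hq, sub_eq_add_neg]
  have Dσ : fderiv ℝ (fun q ↦ -(2 * σ q)) p (e₃ p) = -(2 * fderiv ℝ σ p (e₃ p)) := by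
    rw [fderiv_fun_neg, fderiv_const_mul (smooth_at hσ)]
    simp
  rw [Filter.EventuallyEq.rfl.lieBracket_vectorField_eq E₂₃,
    Filter.EventuallyEq.rfl.lieBracket_vectorField_eq E₁₃,
    E₁₂.lieBracket_vectorField_eq Filter.EventuallyEq.rfl,
    lieBracket_add_left ((c₁.fun_smul d₁).add (c₂.fun_smul d₂)) (cσ.fun_smul d₃),
    lieBracket_add_left (c₁.fun_smul d₁) (c₂.fun_smul d₂),
    lieBracket_smul_left c₁ d₁, lieBracket_smul_left c₂ d₂, lieBracket_smul_left cσ d₃,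
    lieBracket_smul_right (smooth_at hκ₁) d₃, lieBracket_smul_right (smooth_at hκ₂) d₃,
    hb₁₃ p hp, hb₂₃ p hp, lieBracket_self, Dσ] at jacobi
  have key := Fintype.linearIndependent_iff.1 (hind p hp)
    ![fderiv ℝ f₁ p (e₃ p), fderiv ℝ f₂ p (e₃ p),
      -(2 * fderiv ℝ σ p (e₃ p) + κ₁ p * f₁ p + κ₂ p * f₂ p
        + fderiv ℝ κ₁ p (e₂ p) - fderiv ℝ κ₂ p (e₁ p))] (by
      simp only [Fin.sum_univ_three, Matrix.cons_val]
      rw [← sub_eq_zero] at jacobi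
      rw [← jacobi]
      simp only [Pi.zero_apply]
      module)
  exact ⟨key 0, key 1, neg_eq_zero.1 (key 2)⟩
end

section
/- Let U ⊆ ℝ³ be open and let e₁, e₂, e₃ : U → ℝ³ be C^∞ vector fields, and f₁, f₂, κ₁, κ₂, σ : U → ℝ be C^∞ functions such that on U: [e₁,e₃] = κ₁·e₃, [e₂,e₃] = κ₂·e₃, [e₁,e₂] = f₁·e₁ + f₂·e₂ − 2σ·e₃, the directional derivatives of f₁ and f₂ along e₃ vanish identically, and the function p ↦ (Df₁)_p(e₂(p)) − (Df₂)_p(e₁(p)) + f₁(p)² + f₂(p)² + 3σ(p)² is constant on U. Then σ(p)·(Dσ)_p(e₃(p)) = 0 for every p ∈ U. -/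
open VectorField

/-- If `[V, W]` is pointwise a multiple of `W` and `W(h)` vanishes near `p`, then `W(V(h))`
vanishes at `p`. -/
theorem fderiv_fderiv_apply_eq_zero_of_lieBracket_eq_smul
    {E : Type*} [NormedAddCommGroup E] [NormedSpace ℝ E] {V W : E → E} {h : E → ℝ} {p : E} {k : ℝ}
    (hh : ContDiffAt ℝ 2 h p) (hV : DifferentiableAt ℝ V p) (hW : DifferentiableAt ℝ W p)
    (hb : lieBracket ℝ V W p = k • W p) (hz : ∀ᶠ q in nhds p, fderiv ℝ h q (W q) = 0) :
    fderiv ℝ (fun q => fderiv ℝ h q (V q)) p (W p) = 0 := by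
  have hWh : fderiv ℝ (fun q => fderiv ℝ h q (W q)) p = 0 := by
    have hc : (fun q => fderiv ℝ h q (W q)) =ᶠ[nhds p] fun _ => (0 : ℝ) := hz
    rw [hc.fderiv_eq]
    simp
  have key := fderiv_apply_lieBracket hh (by simp) hW hV
  rw [hb, map_smul, hz.self_of_nhds, hWh] at key
  simpa using key

/-- Key step in Lemma 3.1: for an adapted frame with integrability data `f₁, f₂, κ₁, κ₂, σ`
on an open set `U ⊆ ℝ³` satisfying the bracket relations, if `e₃(f₁) = e₃(f₂) = 0` on `U`
and `e₂(f₁) − e₁(f₂) + f₁² + f₂² + 3σ²` is constant on `U` (the curvature equation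
`R^M_{1212} = c` of a space form), then `σ·e₃(σ) = 0` on `U`. -/
theorem sigma_e3_sigma_vanishes
    (U : Set (ℝ × ℝ × ℝ)) (hU : IsOpen U)
    (e₁ e₂ e₃ : ℝ × ℝ × ℝ → ℝ × ℝ × ℝ)
    (he₁ : ContDiffOn ℝ (⊤ : ℕ∞) e₁ U) (he₂ : ContDiffOn ℝ (⊤ : ℕ∞) e₂ U) (he₃ : ContDiffOn ℝ (⊤ : ℕ∞) e₃ U)
    (f₁ f₂ κ₁ κ₂ σ : ℝ × ℝ × ℝ → ℝ)
    (hf₁ : ContDiffOn ℝ (⊤ : ℕ∞) f₁ U) (hf₂ : ContDiffOn ℝ (⊤ : ℕ∞) f₂ U)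
    (hκ₁ : ContDiffOn ℝ (⊤ : ℕ∞) κ₁ U) (hκ₂ : ContDiffOn ℝ (⊤ : ℕ∞) κ₂ U)
    (hσ : ContDiffOn ℝ (⊤ : ℕ∞) σ U)
    (hb₁₃ : ∀ p ∈ U, lieBracket ℝ e₁ e₃ p = κ₁ p • e₃ p)
    (hb₂₃ : ∀ p ∈ U, lieBracket ℝ e₂ e₃ p = κ₂ p • e₃ p)
    (hb₁₂ : ∀ p ∈ U, lieBracket ℝ e₁ e₂ p = f₁ p • e₁ p + f₂ p • e₂ p - (2 * σ p) • e₃ p)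
    (hf₁e₃ : ∀ p ∈ U, fderiv ℝ f₁ p (e₃ p) = 0)
    (hf₂e₃ : ∀ p ∈ U, fderiv ℝ f₂ p (e₃ p) = 0)
    (hconst : ∃ c : ℝ, ∀ p ∈ U,
      fderiv ℝ f₁ p (e₂ p) - fderiv ℝ f₂ p (e₁ p)
        + f₁ p ^ 2 + f₂ p ^ 2 + 3 * σ p ^ 2 = c) :
    ∀ p ∈ U, σ p * fderiv ℝ σ p (e₃ p) = 0 := by
  intro p hp
  have hUp : U ∈ nhds p := hU.mem_nhds hp
  obtain ⟨c, hc⟩ := hconst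
  have d₁ := (he₁.contDiffAt hUp).differentiableAt (by simp)
  have d₂ := (he₂.contDiffAt hUp).differentiableAt (by simp)
  have d₃ := (he₃.contDiffAt hUp).differentiableAt (by simp)
  have cf₁ : ContDiffAt ℝ 2 f₁ p := (hf₁.contDiffAt hUp).of_le (WithTop.coe_le_coe.2 le_top)
  have cf₂ : ContDiffAt ℝ 2 f₂ p := (hf₂.contDiffAt hUp).of_le (WithTop.coe_le_coe.2 le_top)
  have df₁ := (cf₁.differentiableAt (by simp)).hasFDerivAt
  have df₂ := (cf₂.differentiableAt (by simp)).hasFDerivAt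
  have dσ := ((hσ.contDiffAt hUp).differentiableAt (by simp)).hasFDerivAt
  have h₂₁ := fderiv_fderiv_apply_eq_zero_of_lieBracket_eq_smul cf₁ d₂ d₃ (hb₂₃ p hp)
    (Filter.mem_of_superset hUp hf₁e₃)
  have h₁₂ := fderiv_fderiv_apply_eq_zero_of_lieBracket_eq_smul cf₂ d₁ d₃ (hb₁₃ p hp)
    (Filter.mem_of_superset hUp hf₂e₃)
  have D₁ := (((cf₁.fderiv_right (m := 1) (by norm_num)).differentiableAt
    (by simp)).clm_apply d₂).hasFDerivAt
  have D₂ := (((cf₂.fderiv_right (m := 1) (by norm_num)).differentiableAt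
    (by simp)).clm_apply d₁).hasFDerivAt
  have hsum := (((D₁.sub D₂).add (df₁.pow 2)).add (df₂.pow 2)).add
    ((dσ.pow 2).const_mul 3)
  have hzero := hsum.unique ((hasFDerivAt_const c p).congr_of_eventuallyEq
    (Filter.mem_of_superset hUp hc))
  have happ := congrArg (fun L => L (e₃ p)) hzero
  simpa [h₂₁, h₁₂, hf₁e₃ p hp, hf₂e₃ p hp] using happ
end

section
/- Let I ⊆ ℝ be an open interval, c ∈ ℝ, and let κ, σ, f₂ : I → ℝ be functions with κ twice differentiable and σ differentiable on I, satisfying for all x ∈ I: κ'(x) = κ(x)² − σ(x)² + c, σ'(x) = 2κ(x)σ(x), σ(x)² − κ(x)·f₂(x) = c, and −κ''(x) + f₂(x)κ'(x) + κ(x)κ'(x) + κ(x)·(f₂(x)² − c − 3σ(x)²) = 0. Then κ(x) = 0 for all x ∈ I. -/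
/-- Differentiating a relation `σ² = aκ² + b` along `κ' = κ² − σ² + c`, `σ' = 2κσ`, at a point
where `κ ≠ 0` and `σ² = κ²/3 + c`, gives `σ² = aκ²/3` there. -/
lemma sq_eq_of_eventually_sq_eq {κ σ : ℝ → ℝ} {a b c x : ℝ}
    (hκ : HasDerivAt κ (κ x ^ 2 - σ x ^ 2 + c) x) (hσ : HasDerivAt σ (2 * κ x * σ x) x)
    (hne : κ x ≠ 0) (hx : σ x ^ 2 = 1 / 3 * κ x ^ 2 + c)
    (h : ∀ᶠ y in nhds x, σ y ^ 2 = a * κ y ^ 2 + b) :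
    σ x ^ 2 = a / 3 * κ x ^ 2 := by
  have hderiv := (hσ.fun_pow 2).unique
    ((((hκ.fun_pow 2).const_mul a).add_const b).congr_of_eventuallyEq h)
  norm_num at hderiv
  refine mul_left_cancel₀ hne ?_
  linear_combination hderiv / 4 - a * κ x / 2 * hx

/-- Analytic core of Theorem 3.3: along an integral curve of `e₁`, the constant-curvature
equations `κ' = κ² − σ² + c`, `σ' = 2κσ`, `σ² − κf₂ = c` together with the biharmonicity
equation `−κ'' + f₂κ' + κκ' + κ(f₂² − c − 3σ²) = 0` force `κ ≡ 0`
(hence the submersion is harmonic). -/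
theorem biharmonic_space_form_implies_harmonic
    (I : Set ℝ) (hI : IsOpen I) (hI' : I.OrdConnected) (c : ℝ)
    (κ σ f₂ : ℝ → ℝ)
    (hκdiff : ∀ x ∈ I, DifferentiableAt ℝ κ x)
    (hκdiff2 : ∀ x ∈ I, DifferentiableAt ℝ (deriv κ) x)
    (hσdiff : ∀ x ∈ I, DifferentiableAt ℝ σ x)
    (hκ' : ∀ x ∈ I, deriv κ x = κ x ^ 2 - σ x ^ 2 + c)
    (hσ' : ∀ x ∈ I, deriv σ x = 2 * κ x * σ x)
    (hcurv : ∀ x ∈ I, σ x ^ 2 - κ x * f₂ x = c)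
    (hbih : ∀ x ∈ I, -(deriv (deriv κ) x) + f₂ x * deriv κ x + κ x * deriv κ x
      + κ x * (f₂ x ^ 2 - c - 3 * σ x ^ 2) = 0) :
    ∀ x ∈ I, κ x = 0 := by
  intro x₀ hx₀
  by_contra hne
  have hopen : ∀ x ∈ I, κ x ≠ 0 → ∀ᶠ y in nhds x, y ∈ I ∧ κ y ≠ 0 := fun x hx hk =>
    (hI.eventually_mem hx).and ((hκdiff x hx).continuousAt.eventually_ne hk)
  have hκd : ∀ x ∈ I, HasDerivAt κ (κ x ^ 2 - σ x ^ 2 + c) x := fun x hx =>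
    hκ' x hx ▸ (hκdiff x hx).hasDerivAt
  have hσd : ∀ x ∈ I, HasDerivAt σ (2 * κ x * σ x) x := fun x hx =>
    hσ' x hx ▸ (hσdiff x hx).hasDerivAt
  have hκ'' : ∀ x ∈ I, deriv (deriv κ) x
      = 2 * κ x * (κ x ^ 2 - σ x ^ 2 + c) - 4 * κ x * σ x ^ 2 := by
    intro x hx
    have heq : deriv κ =ᶠ[nhds x] fun y => κ y ^ 2 - σ y ^ 2 + c :=
      Filter.eventually_of_mem (hI.mem_nhds hx) hκ'
    rw [heq.deriv_eq,
      ((((hκd x hx).fun_pow 2).fun_sub ((hσd x hx).fun_pow 2)).add_const c).deriv]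
    norm_num
    ring
  have hσκ : ∀ x ∈ I, κ x ≠ 0 → σ x ^ 2 = 1 / 3 * κ x ^ 2 + c := by
    intro x hx hk
    have hb := hbih x hx
    rw [hκ'' x hx, hκ' x hx] at hb
    have hc := hcurv x hx
    have hf : κ x ^ 2 * (κ x - 3 * f₂ x) = 0 := by
      rw [← hc] at hb
      linear_combination -hb
    have hf' : κ x - 3 * f₂ x = 0 := by simpa [hk] using hf
    linear_combination hc - κ x / 3 * hf'
  have hstep := fun x hx hk (a b : ℝ) h =>
    sq_eq_of_eventually_sq_eq (hκd x hx) (hσd x hx) hk (hσκ x hx hk) (a := a) (b := b) h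
  have hσκ' : ∀ x ∈ I, κ x ≠ 0 → σ x ^ 2 = 1 / 3 / 3 * κ x ^ 2 := fun x hx hk =>
    hstep x hx hk (1 / 3) c ((hopen x hx hk).mono fun y hy => hσκ y hy.1 hy.2)
  have hσκ'' := hstep x₀ hx₀ hne (1 / 3 / 3) 0 ((hopen x₀ hx₀ hne).mono fun y hy => by
    rw [hσκ' y hy.1 hy.2, add_zero])
  have hpos : 0 < κ x₀ ^ 2 := by positivity
  linarith [hσκ' x₀ hx₀ hne]
end

section
/- Let I ⊆ ℝ be an open interval, c ∈ ℝ, and let κ, σ, f₂ : I → ℝ be functions with κ twice differentiable and σ differentiable on I, satisfying for all x ∈ I: κ'(x) = κ(x)² − σ(x)² + c, σ'(x) = 2κ(x)σ(x), σ(x)² − κ(x)·f₂(x) = c, and −κ''(x) + f₂(x)κ'(x) + κ(x)κ'(x) + κ(x)·(f₂(x)² − c − 3σ(x)²) = 0. Then κ(x)·(3σ(x)² − κ(x)² − 3c) = 0 for all x ∈ I. -/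
/-- Equation (d81) in the proof of Theorem 3.3: along an integral curve of `e₁`, the
constant-curvature equations `κ' = κ² − σ² + c`, `σ' = 2κσ`, `σ² − κf₂ = c` and the
biharmonicity equation `−κ'' + f₂κ' + κκ' + κ(f₂² − c − 3σ²) = 0` combine into the
pointwise identity `κ(3σ² − κ² − 3c) = 0`. -/
theorem biharmonic_equation_reduction
    (I : Set ℝ) (hI : IsOpen I) (hI' : I.OrdConnected) (c : ℝ)
    (κ σ f₂ : ℝ → ℝ)
    (hκdiff : ∀ x ∈ I, DifferentiableAt ℝ κ x)
    (hκdiff2 : ∀ x ∈ I, DifferentiableAt ℝ (deriv κ) x)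
    (hσdiff : ∀ x ∈ I, DifferentiableAt ℝ σ x)
    (hκ' : ∀ x ∈ I, deriv κ x = κ x ^ 2 - σ x ^ 2 + c)
    (hσ' : ∀ x ∈ I, deriv σ x = 2 * κ x * σ x)
    (hcurv : ∀ x ∈ I, σ x ^ 2 - κ x * f₂ x = c)
    (hbih : ∀ x ∈ I, -(deriv (deriv κ) x) + f₂ x * deriv κ x + κ x * deriv κ x
      + κ x * (f₂ x ^ 2 - c - 3 * σ x ^ 2) = 0) :
    ∀ x ∈ I, κ x * (3 * σ x ^ 2 - κ x ^ 2 - 3 * c) = 0 := by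
  intro x hx
  have hκ'' : deriv (deriv κ) x = 2 * κ x * deriv κ x - 2 * σ x * deriv σ x := by
    have heq : deriv κ =ᶠ[nhds x] fun y => κ y ^ 2 - σ y ^ 2 + c :=
      Filter.eventually_of_mem (hI.mem_nhds hx) hκ'
    have hderiv := (((hκdiff x hx).hasDerivAt.pow 2).sub
      ((hσdiff x hx).hasDerivAt.pow 2)).add_const c
    rw [(hderiv.congr_of_eventuallyEq heq).deriv]
    norm_num
  have hb := hbih x hx
  rw [hκ'', hσ' x hx, hκ' x hx] at hb
  linear_combination hb + (κ x + f₂ x) * hcurv x hx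
end
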